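/- (Failure of the strong Gehring lemma in spaces of homogeneous type.) In the metric measure space (X,d,μ) described below, fix 0 < α < 1, let h(t) := t^{-α}·(log(e/t))^{-1}, and let f be the weight built from h and any sequence (ε_j) with ε_j ∈ (0,1] and ε_j → 0. Then f ∈ RH_p for every p with 1 < p ≤ 1/α (i.e. there is a finite constant C with (⨍_B f^p dμ)^{1/p} ≤ C·⨍_B f dμ for all balls B of X), while f ∉ RH_p for every p > 1/α. In particular, f ∈ RH_{1/α} but f belongs to no RH_{1/α + ε} with ε > 0, so the strong self-improvement 'RH_q ⇒ RH_{q+ε}' fails in this space. -/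

import Mathlib

open MeasureTheory ENNReal

namespace Counterexample

/-- The infinite line `A = ℝ × {0}`. -/
def lineA : Set (ℝ × ℝ) := {p | p.2 = 0}

/-- The slanted segment `U = {(u, u/2) : u ∈ (0,1]}`. -/
def segU : Set (ℝ × ℝ) := {p | ∃ u : ℝ, 0 < u ∧ u ≤ 1 ∧ p = (u, u / 2)}

/-- The vertical segment `V = {1} × [1/2, 1]`. -/
def segV : Set (ℝ × ℝ) := {p | p.1 = 1 ∧ 1 / 2 ≤ p.2 ∧ p.2 ≤ 1}

/-- `W = U ∪ V`. -/
def segW : Set (ℝ × ℝ) := segU ∪ segV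

/-- `W_j = W + (10j, 0)`. -/
def segWj (j : ℕ) : Set (ℝ × ℝ) := (fun p => p + ((10 * j : ℝ), 0)) '' segW

/-- The space `X = A ∪ ⋃_j W_j`.  (Recall that the product metric on `ℝ × ℝ` in Mathlib is
exactly the sup-metric `d((u₁,v₁),(u₂,v₂)) = max(|u₁-u₂|, |v₁-v₂|)`.) -/
def spaceX : Set (ℝ × ℝ) := lineA ∪ ⋃ j : ℕ, segWj j

/-- The one-dimensional Hausdorff measure on `X`, realized as the restriction to `X` of the
one-dimensional Hausdorff measure of `(ℝ², ℓ^∞)`. -/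
noncomputable def muX : Measure (ℝ × ℝ) := (μH[1]).restrict spaceX

/-- The ball of `X` centered at `z ∈ X` of radius `r`, as a subset of `ℝ × ℝ`. -/
def ballX (z : ℝ × ℝ) (r : ℝ) : Set (ℝ × ℝ) := Metric.ball z r ∩ spaceX

/-- The non-centered Hardy-Littlewood maximal operator on `X`: the supremum of averages
over balls of `X` containing the point. -/
noncomputable def mOpX (f : ℝ × ℝ → ℝ≥0∞) (x : ℝ × ℝ) : ℝ≥0∞ :=
  ⨆ (z : ℝ × ℝ) (_ : z ∈ spaceX) (r : ℝ) (_ : 0 < r) (_ : x ∈ Metric.ball z r),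
    (muX (Metric.ball z r))⁻¹ * ∫⁻ y in Metric.ball z r, f y ∂muX

/-- `g(t) = max {h(t), 1}`. -/
noncomputable def gfun (h : ℝ → ℝ) (t : ℝ) : ℝ := max (h t) 1

/-- The weight `f = f_h` built from `h` and the sequence `(ε_j)`: it equals `1` on `A`,
`ε_j` on `V_j`, and `min {1, ε_j g(u)}` at the point `(10j + u, u/2) ∈ U_j`. -/
noncomputable def fwt (h : ℝ → ℝ) (eps : ℕ → ℝ) (p : ℝ × ℝ) : ℝ≥0∞ :=
  if p.2 = 0 then 1
  else if p.2 = (p.1 - 10 * (⌊p.1 / 10⌋ : ℝ)) / 2 then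
    ENNReal.ofReal (min 1 (eps ⌊p.1 / 10⌋.toNat * gfun h (p.1 - 10 * (⌊p.1 / 10⌋ : ℝ))))
  else ENNReal.ofReal (eps ⌊p.1 / 10⌋.toNat)

/-- The function `h(t) = t^{-α} (log(e/t))⁻¹`. -/
noncomputable def h19 (α t : ℝ) : ℝ := t ^ (-α) * (Real.log (Real.exp 1 / t))⁻¹

/-! ### Isometric parametrizations of the pieces of `X` -/

/-- The parametrization of the line `A`. -/
def lineMap (x : ℝ) : ℝ × ℝ := (x, 0)

/-- The parametrization of `U_j`. -/
noncomputable def slantMap (j : ℕ) (u : ℝ) : ℝ × ℝ := (10 * j + u, u / 2)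

/-- The parametrization of `V_j`. -/
noncomputable def vertMap (j : ℕ) (y : ℝ) : ℝ × ℝ := (10 * j + 1, y)

lemma isometry_lineMap : Isometry lineMap :=
  Isometry.of_dist_eq fun x y => by simp [lineMap, Prod.dist_eq]

lemma isometry_slantMap (j : ℕ) : Isometry (slantMap j) :=
  Isometry.of_dist_eq fun x y => by
    have h : |x / 2 - y / 2| = |x - y| / 2 := by
      rw [← sub_div, abs_div, abs_of_pos (two_pos : (0 : ℝ) < 2)]
    simp only [slantMap, Prod.dist_eq, Real.dist_eq, add_sub_add_left_eq_sub, h]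
    exact max_eq_left (by linarith [abs_nonneg (x - y)])

lemma isometry_vertMap (j : ℕ) : Isometry (vertMap j) :=
  Isometry.of_dist_eq fun x y => by simp [vertMap, Prod.dist_eq]

lemma segWj_eq (j : ℕ) :
    segWj j = slantMap j '' Set.Ioc 0 1 ∪ vertMap j '' Set.Icc (1 / 2) 1 := by
  ext ⟨x, y⟩
  simp only [segWj, segW, Set.image_union]
  refine or_congr ?_ ?_
  · constructor
    · rintro ⟨_, ⟨u, h0, h1, rfl⟩, h⟩
      refine ⟨u, ⟨h0, h1⟩, ?_⟩
      rw [← h]; simp [slantMap, add_comm]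
    · rintro ⟨u, ⟨h0, h1⟩, h⟩
      refine ⟨(u, u / 2), ⟨u, h0, h1, rfl⟩, ?_⟩
      rw [← h]; simp [slantMap, add_comm]
  · constructor
    · rintro ⟨⟨a, b⟩, ⟨ha, h0, h1⟩, h⟩
      refine ⟨b, ⟨h0, h1⟩, ?_⟩
      simp only at ha
      rw [← h, ha]; simp [vertMap, add_comm]
    · rintro ⟨u, ⟨h0, h1⟩, h⟩
      refine ⟨(1, u), ⟨rfl, h0, h1⟩, ?_⟩
      rw [← h]; simp [vertMap, add_comm]

lemma lineA_eq : lineA = lineMap '' Set.univ := by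
  ext ⟨x, y⟩
  simp [lineA, lineMap, eq_comm]

lemma measurableSet_image_of_isometry {φ : ℝ → ℝ × ℝ} (hφ : Isometry φ) {S : Set ℝ}
    (hS : MeasurableSet S) : MeasurableSet (φ '' S) :=
  hφ.isClosedEmbedding.measurableEmbedding.measurableSet_image.2 hS

lemma measurableSet_spaceX : MeasurableSet spaceX := by
  refine MeasurableSet.union ?_ (MeasurableSet.iUnion fun j => ?_)
  · rw [lineA_eq]
    exact measurableSet_image_of_isometry isometry_lineMap .univ
  · rw [segWj_eq]
    exact (measurableSet_image_of_isometry (isometry_slantMap j) measurableSet_Ioc).union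
      (measurableSet_image_of_isometry (isometry_vertMap j) measurableSet_Icc)

lemma measurableSet_ballX (z : ℝ × ℝ) (r : ℝ) : MeasurableSet (ballX z r) :=
  measurableSet_ball.inter measurableSet_spaceX

lemma muX_ball (z : ℝ × ℝ) (r : ℝ) : muX (Metric.ball z r) = μH[1] (ballX z r) := by
  rw [muX, Measure.restrict_apply measurableSet_ball, ballX]

lemma lintegral_ball_muX (z : ℝ × ℝ) (r : ℝ) (F : ℝ × ℝ → ℝ≥0∞) :
    ∫⁻ x in Metric.ball z r, F x ∂muX = ∫⁻ x in ballX z r, F x ∂μH[1] := by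
  rw [muX, Measure.restrict_restrict measurableSet_ball, ballX]

lemma lintegral_image_of_isometry {φ : ℝ → ℝ × ℝ} (hφ : Isometry φ) (S : Set ℝ)
    (F : ℝ × ℝ → ℝ≥0∞) : ∫⁻ x in φ '' S, F x ∂μH[1] = ∫⁻ t in S, F (φ t) := by
  have me := hφ.isClosedEmbedding.measurableEmbedding
  have h : (μH[1] : Measure (ℝ × ℝ)).restrict (φ '' S) =
      (Measure.map φ (volume : Measure ℝ)).restrict (φ '' S) := by
    rw [← hausdorffMeasure_real, hφ.map_hausdorffMeasure (Or.inl zero_le_one),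
      Measure.restrict_restrict_of_subset (Set.image_subset_range _ _)]
  rw [h, me.restrict_map, me.lintegral_map, Set.preimage_image_eq _ hφ.injective]

lemma hausdorffMeasure_image_of_isometry {φ : ℝ → ℝ × ℝ} (hφ : Isometry φ) (S : Set ℝ) :
    μH[1] (φ '' S) = volume S := by
  rw [hφ.hausdorffMeasure_image (Or.inl zero_le_one), hausdorffMeasure_real]

lemma mem_spaceX {w : ℝ × ℝ} : w ∈ spaceX ↔ w.2 = 0 ∨
    ∃ j, (∃ u ∈ Set.Ioc (0 : ℝ) 1, w = slantMap j u) ∨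
      ∃ y ∈ Set.Icc (1 / 2 : ℝ) 1, w = vertMap j y := by
  simp only [spaceX, segWj_eq, Set.mem_union, Set.mem_iUnion, Set.mem_image, eq_comm (a := w)]
  rfl

lemma mem_ball_iff {z w : ℝ × ℝ} {r : ℝ} :
    w ∈ Metric.ball z r ↔ |w.1 - z.1| < r ∧ |w.2 - z.2| < r := by
  simp [Metric.mem_ball, Prod.dist_eq, Real.dist_eq]

/-! ### Size of balls -/

lemma tsum_volume_Ioc_inter_le (c a b : ℝ) :
    ∑' j : ℕ, volume (Set.Ioc (10 * j + c) (10 * j + c + 1) ∩ Set.Ioo a b)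
      ≤ ENNReal.ofReal (b - a) := by
  have hdisj : Pairwise (Function.onFun Disjoint fun j : ℕ =>
      Set.Ioc (10 * (j : ℝ) + c) (10 * j + c + 1) ∩ Set.Ioo a b) := by
    intro i j hij
    refine Disjoint.inter_left _ (Disjoint.inter_right _ ?_)
    rw [Set.disjoint_left]
    rintro x ⟨h1, h2⟩ ⟨h3, h4⟩
    rcases lt_or_gt_of_ne hij with h | h
    · have : (i : ℝ) + 1 ≤ j := by exact_mod_cast h
      linarith
    · have : (j : ℝ) + 1 ≤ i := by exact_mod_cast h
      linarith
  rw [← measure_iUnion hdisj fun j => measurableSet_Ioc.inter measurableSet_Ioo,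
    ← Real.volume_Ioo]
  exact measure_mono (Set.iUnion_subset fun j => Set.inter_subset_right)

lemma volume_vert_le (j : ℕ) (a b r : ℝ) :
    volume {y | y ∈ Set.Icc (1 / 2 : ℝ) 1 ∧ |10 * (j : ℝ) + 1 - a| < r ∧ |y - b| < r}
      ≤ volume (Set.Ioc (10 * (j : ℝ) + 1) (10 * j + 1 + 1) ∩
          Set.Ioo (a - 3 * r) (a + 3 * r)) := by
  by_cases hj : |10 * (j : ℝ) + 1 - a| < r
  · have hr := (abs_nonneg _).trans_lt hj
    rw [abs_lt] at hj
    calc _ ≤ ENNReal.ofReal (min (1 / 2) (2 * r)) := by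
          rw [ENNReal.ofReal_min]
          refine le_min ?_ ?_
          · refine (measure_mono (t := Set.Icc (1 / 2 : ℝ) 1) fun y hy => hy.1).trans ?_
            rw [Real.volume_Icc]; norm_num
          · refine (measure_mono (t := Set.Ioo (b - r) (b + r)) fun y hy => ?_).trans ?_
            · have := abs_lt.1 hy.2.2
              exact ⟨by linarith, by linarith⟩
            · rw [Real.volume_Ioo]
              exact ENNReal.ofReal_le_ofReal (by linarith)
      _ = volume (Set.Ioo (10 * (j : ℝ) + 1) (10 * j + 1 + min (1 / 2) (2 * r))) := by
          rw [Real.volume_Ioo]; congr 1; ring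
      _ ≤ _ := by
          refine measure_mono fun y hy => ?_
          have h1 := min_le_left (1 / 2) (2 * r)
          have h2 := min_le_right (1 / 2) (2 * r)
          have h3 := hy.1
          have h4 := hy.2
          exact ⟨⟨h3, by linarith⟩, by linarith, by linarith⟩
  · simp [hj]

lemma hausdorffMeasure_ballX_le (z : ℝ × ℝ) {r : ℝ} (hr : 0 < r) :
    μH[1] (ballX z r) ≤ ENNReal.ofReal (10 * r) := by
  have hsub : ballX z r ⊆ lineMap '' Set.Ioo (z.1 - r) (z.1 + r) ∪
      ((⋃ j : ℕ, slantMap j '' ((fun u => 10 * (j : ℝ) + u) ⁻¹'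
        (Set.Ioc (10 * j + 0) (10 * j + 0 + 1) ∩ Set.Ioo (z.1 - r) (z.1 + r)))) ∪
      ⋃ j : ℕ, vertMap j ''
        {y | y ∈ Set.Icc (1 / 2 : ℝ) 1 ∧ |10 * (j : ℝ) + 1 - z.1| < r ∧ |y - z.2| < r}) := by
    rintro w ⟨hb, hX⟩
    rw [mem_ball_iff] at hb
    have h1 := abs_lt.1 hb.1
    rcases mem_spaceX.1 hX with h | ⟨j, ⟨u, hu, rfl⟩ | ⟨y, hy, rfl⟩⟩
    · exact Or.inl ⟨w.1, ⟨by linarith, by linarith⟩, Prod.ext rfl h.symm⟩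
    · refine Or.inr (Or.inl (Set.mem_iUnion.2 ⟨j, u, ⟨⟨?_, ?_⟩, ?_, ?_⟩, rfl⟩))
      · linarith [hu.1]
      · linarith [hu.2]
      · simp only [slantMap] at h1; linarith
      · simp only [slantMap] at h1; linarith
    · exact Or.inr (Or.inr (Set.mem_iUnion.2 ⟨j, y, ⟨hy, hb.1, hb.2⟩, rfl⟩))
  calc μH[1] (ballX z r) ≤ _ := measure_mono hsub
    _ ≤ ENNReal.ofReal (2 * r) + (ENNReal.ofReal (2 * r) + ENNReal.ofReal (6 * r)) := by
      refine (measure_union_le _ _).trans (add_le_add ?_ ((measure_union_le _ _).trans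
        (add_le_add ?_ ?_)))
      · rw [hausdorffMeasure_image_of_isometry isometry_lineMap, Real.volume_Ioo]
        exact ENNReal.ofReal_le_ofReal (by linarith)
      · refine (measure_iUnion_le _).trans ?_
        simp only [hausdorffMeasure_image_of_isometry (isometry_slantMap _),
          measure_preimage_add]
        exact (tsum_volume_Ioc_inter_le _ _ _).trans (ENNReal.ofReal_le_ofReal (by linarith))
      · refine (measure_iUnion_le _).trans ?_
        simp only [hausdorffMeasure_image_of_isometry (isometry_vertMap _)]
        exact (ENNReal.tsum_le_tsum fun j => volume_vert_le j _ _ _).trans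
          ((tsum_volume_Ioc_inter_le _ _ _).trans (ENNReal.ofReal_le_ofReal (by linarith)))
    _ = ENNReal.ofReal (10 * r) := by
      rw [← ENNReal.ofReal_add (by positivity) (by positivity),
        ← ENNReal.ofReal_add (by positivity) (by positivity)]
      congr 1; ring

lemma hausdorffMeasure_ballX_ne_top (z : ℝ × ℝ) {r : ℝ} (hr : 0 < r) :
    μH[1] (ballX z r) ≠ ⊤ :=
  ((hausdorffMeasure_ballX_le z hr).trans_lt ENNReal.ofReal_lt_top).ne

/-- A ball of `X` not meeting `A` is contained in a single `W_j`. -/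
lemma ballX_cases {z w : ℝ × ℝ} {r : ℝ} {j : ℕ} (hz1 : 10 * (j : ℝ) < z.1)
    (hz1' : z.1 ≤ 10 * j + 1) (hz2 : z.2 ≤ 1) (hr : r ≤ z.2) (hw : w ∈ ballX z r) :
    (∃ u ∈ Set.Ioc (0 : ℝ) 1, w = slantMap j u) ∨
      ∃ y ∈ Set.Icc (1 / 2 : ℝ) 1, w = vertMap j y := by
  have hb := mem_ball_iff.1 hw.1
  have h1 := abs_lt.1 hb.1
  have h2 := abs_lt.1 hb.2
  rcases mem_spaceX.1 hw.2 with h | ⟨k, hk⟩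
  · linarith
  have hk' : 10 * (k : ℝ) < w.1 ∧ w.1 ≤ 10 * k + 1 := by
    rcases hk with ⟨u, hu, rfl⟩ | ⟨y, hy, rfl⟩
    · simp only [slantMap]; exact ⟨by linarith [hu.1], by linarith [hu.2]⟩
    · simp only [vertMap]; exact ⟨by linarith, le_rfl⟩
  have hkj : k = j := by
    have h3 : (k : ℝ) < j + 1 := by linarith
    have h4 : (j : ℝ) < k + 1 := by linarith
    have h5 : k < j + 1 := by exact_mod_cast h3
    have h6 : j < k + 1 := by exact_mod_cast h4
    omega
  exact hkj ▸ hk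

/-! ### The profile `g` -/

lemma one_le_gfun (h : ℝ → ℝ) (t : ℝ) : 1 ≤ gfun h t := le_max_right _ _

lemma h19_eq {α t : ℝ} (ht : 0 < t) : h19 α t = t ^ (-α) * (1 - Real.log t)⁻¹ := by
  rw [h19, Real.log_div (Real.exp_pos 1).ne' ht.ne', Real.log_exp]

lemma one_le_one_sub_log {t : ℝ} (ht0 : 0 < t) (ht1 : t ≤ 1) : 1 ≤ 1 - Real.log t := by
  linarith [Real.log_nonpos ht0.le ht1]

lemma gfun_h19_one (α : ℝ) : gfun (h19 α) 1 = 1 := by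
  simp [gfun, h19_eq]

lemma gfun_h19_le_rpow {α t : ℝ} (hα : 0 < α) (ht0 : 0 < t) (ht1 : t ≤ 1) :
    gfun (h19 α) t ≤ t ^ (-α) := by
  refine max_le ?_ (Real.one_le_rpow_of_pos_of_le_one_of_nonpos ht0 ht1 (by linarith))
  rw [h19_eq ht0]
  exact mul_le_of_le_one_right (by positivity) (inv_le_one_of_one_le₀ (one_le_one_sub_log ht0 ht1))

/-- `g` is essentially constant on dyadic scales. -/
lemma gfun_h19_le_four_mul {α s t : ℝ} (hα0 : 0 < α) (hα1 : α < 1) (hs0 : 0 < s) (hs1 : s ≤ 1)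
    (ht0 : 0 < t) (ht1 : t ≤ 1) (hts : t ≤ 2 * s) (hst : s ≤ 2 * t) :
    gfun (h19 α) s ≤ 4 * gfun (h19 α) t := by
  have hls := one_le_one_sub_log hs0 hs1
  have hlt := one_le_one_sub_log ht0 ht1
  have h1 : s ^ (-α) ≤ 2 * t ^ (-α) := by
    calc s ^ (-α) ≤ (2⁻¹ * t) ^ (-α) :=
          Real.rpow_le_rpow_of_nonpos (by positivity) (by linarith) (by linarith)
      _ = 2 ^ α * t ^ (-α) := by
          rw [Real.mul_rpow (by norm_num) ht0.le, Real.inv_rpow (by norm_num),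
            Real.rpow_neg (by norm_num), inv_inv]
      _ ≤ 2 * t ^ (-α) := by
          gcongr
          calc (2 : ℝ) ^ α ≤ 2 ^ (1 : ℝ) :=
                Real.rpow_le_rpow_of_exponent_le (by norm_num) hα1.le
            _ = 2 := Real.rpow_one 2
  have h2 : (1 - Real.log s)⁻¹ ≤ 2 * (1 - Real.log t)⁻¹ := by
    rw [inv_le_comm₀ (by positivity) (by positivity), mul_inv, inv_inv]
    have h3 : Real.log s ≤ Real.log 2 + Real.log t := by
      rw [← Real.log_mul (by norm_num) ht0.ne']
      exact Real.log_le_log hs0 hst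
    have h4 : Real.log 2 ≤ 1 := by linarith [Real.log_two_lt_d9]
    have h5 : Real.log t ≤ 0 := Real.log_nonpos ht0.le ht1
    linarith
  refine max_le ?_ (by linarith [one_le_gfun (h19 α) t])
  calc h19 α s ≤ (2 * t ^ (-α)) * (2 * (1 - Real.log t)⁻¹) := by
        rw [h19_eq hs0]
        gcongr
    _ = 4 * h19 α t := by rw [h19_eq ht0]; ring
    _ ≤ 4 * gfun (h19 α) t := by gcongr; exact le_max_left _ _

lemma inv_mul_one_sub_log_rpow_integrableOn {q : ℝ} (hq : 1 < q) :
    IntegrableOn (fun t : ℝ => t⁻¹ * (1 - Real.log t) ^ (-q)) (Set.Ioc 0 1) := by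
  set F : ℝ → ℝ := fun t => (q - 1)⁻¹ * (1 - Real.log t) ^ (1 - q) with hF
  have hlim : Filter.Tendsto F (nhdsWithin 0 (Set.Ioi 0)) (nhds 0) := by
    have h1 : Filter.Tendsto (fun t => 1 - Real.log t) (nhdsWithin 0 (Set.Ioi 0))
        Filter.atTop := by
      simpa [sub_eq_add_neg] using Filter.tendsto_atTop_add_const_left _ 1
        (Filter.tendsto_neg_atBot_atTop.comp Real.tendsto_log_nhdsGT_zero)
    have h2 := (tendsto_rpow_neg_atTop (show 0 < q - 1 by linarith)).comp h1
    have h3 := h2.const_mul (q - 1)⁻¹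
    rw [mul_zero] at h3
    refine h3.congr fun t => ?_
    simp [hF]
  have hder : ∀ t ∈ Set.Ioc (0 : ℝ) 1,
      HasDerivAt F (t⁻¹ * (1 - Real.log t) ^ (-q)) t := by
    intro t ht
    have hl := one_le_one_sub_log ht.1 ht.2
    have h := (((Real.hasDerivAt_log ht.1.ne').const_sub 1).rpow_const (p := 1 - q)
      (Or.inl (by linarith))).const_mul (q - 1)⁻¹
    refine h.congr_deriv ?_
    have : q - 1 ≠ 0 := by linarith
    rw [show 1 - q - 1 = -q by ring]
    field_simp
    ring
  refine intervalIntegral.integrableOn_deriv_of_nonneg (g := Function.update F 0 0) ?_ ?_ ?_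
  · rw [continuousOn_update_iff]
    refine ⟨fun t ht => (hder t ⟨lt_of_le_of_ne ht.1.1 (Ne.symm ht.2), ht.1.2⟩).continuousAt
      |>.continuousWithinAt, fun _ => hlim.mono_left (nhdsWithin_mono _ fun t ht =>
        lt_of_le_of_ne ht.1.1 (Ne.symm ht.2))⟩
  · intro t ht
    refine (hder t ⟨ht.1, ht.2.le⟩).congr_of_eventuallyEq ?_
    filter_upwards [isOpen_ne.mem_nhds ht.1.ne'] with s hs
    exact Function.update_of_ne hs _ _
  · intro t ht
    have := one_le_one_sub_log ht.1 ht.2.le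
    have := ht.1
    positivity

lemma lintegral_gfun_h19_rpow_lt_top {α : ℝ} (hα0 : 0 < α) (hα1 : α < 1) :
    ∫⁻ t in Set.Ioc (0 : ℝ) 1, ENNReal.ofReal (gfun (h19 α) t) ^ (1 / α) < ⊤ := by
  have hInt := (inv_mul_one_sub_log_rpow_integrableOn ((one_lt_div hα0).2 hα1)).add
    (integrableOn_const (C := (1 : ℝ)) (s := Set.Ioc (0 : ℝ) 1) (by simp))
  refine lt_of_le_of_lt (setLIntegral_mono' measurableSet_Ioc fun t ht => ?_)
    (hInt.lintegral_lt_top)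
  have hl := one_le_one_sub_log ht.1 ht.2
  have ht0 := ht.1
  rw [ENNReal.ofReal_rpow_of_nonneg (by linarith [one_le_gfun (h19 α) t]) (by positivity)]
  refine ENNReal.ofReal_le_ofReal ?_
  have hh : h19 α t ^ (1 / α) = t⁻¹ * (1 - Real.log t) ^ (-(1 / α)) := by
    rw [h19_eq ht0, Real.mul_rpow (by positivity) (by positivity), ← Real.rpow_mul ht0.le,
      Real.inv_rpow (by positivity), ← Real.rpow_neg (by positivity), neg_mul,
      mul_one_div_cancel hα0.ne', Real.rpow_neg_one]
  have : 0 ≤ t⁻¹ * (1 - Real.log t) ^ (-(1 / α)) := by positivity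
  simp only [Pi.add_apply]
  rcases max_cases (h19 α t) 1 with ⟨h, -⟩ | ⟨h, -⟩
  · rw [gfun, h, hh]; linarith
  · rw [gfun, h, Real.one_rpow]; linarith

lemma exists_div_le_gfun_h19_rpow {α p : ℝ} (hα0 : 0 < α) (hp : 1 / α < p) :
    ∃ c : ℝ, 0 < c ∧ ∀ t ∈ Set.Ioc (0 : ℝ) 1, c * t⁻¹ ≤ gfun (h19 α) t ^ p := by
  have hp0 : 0 < p := (by positivity : (0 : ℝ) < 1 / α).trans hp
  set δ := α - 1 / p with hδ
  have hδ0 : 0 < δ := by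
    rw [hδ, sub_pos, one_div_lt hp0 hα0]; exact hp
  refine ⟨((1 + δ⁻¹)⁻¹) ^ p, by positivity, fun t ht => ?_⟩
  have ht0 := ht.1
  have hl := one_le_one_sub_log ht.1 ht.2
  have h1 : 1 - Real.log t ≤ (1 + δ⁻¹) * t ^ (-δ) := by
    have h2 := Real.log_le_rpow_div (inv_nonneg.2 ht0.le) hδ0
    rw [Real.log_inv, Real.inv_rpow ht0.le, ← Real.rpow_neg ht0.le, div_eq_inv_mul] at h2
    have h3 : 1 ≤ t ^ (-δ) :=
      Real.one_le_rpow_of_pos_of_le_one_of_nonpos ht0 ht.2 (by linarith)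
    linarith
  have h4 : (1 + δ⁻¹)⁻¹ * t ^ (-(1 / p)) ≤ h19 α t := by
    rw [h19_eq ht0]
    calc (1 + δ⁻¹)⁻¹ * t ^ (-(1 / p)) = t ^ (-α) * ((1 + δ⁻¹) * t ^ (-δ))⁻¹ := by
          rw [mul_inv, ← Real.rpow_neg ht0.le, neg_neg, mul_left_comm, ← Real.rpow_add ht0]
          congr 2; rw [hδ]; ring
      _ ≤ _ := by gcongr
  calc ((1 + δ⁻¹)⁻¹) ^ p * t⁻¹ = ((1 + δ⁻¹)⁻¹ * t ^ (-(1 / p))) ^ p := by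
        rw [Real.mul_rpow (by positivity) (by positivity), ← Real.rpow_mul ht0.le, neg_mul,
          one_div_mul_cancel hp0.ne', Real.rpow_neg_one]
    _ ≤ gfun (h19 α) t ^ p := by
        gcongr
        exact h4.trans (le_max_left _ _)

lemma setLIntegral_inv_Ioc {s : ℝ} (hs0 : 0 < s) (hs1 : s ≤ 1) :
    ∫⁻ t in Set.Ioc s 1, ENNReal.ofReal t⁻¹ = ENNReal.ofReal (-Real.log s) := by
  have h0 : (0 : ℝ) ∉ Set.uIcc s 1 := by
    rw [Set.uIcc_of_le hs1]; exact fun h => absurd h.1 (not_le.2 hs0)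
  have hInt : IntegrableOn (fun t : ℝ => t⁻¹) (Set.Ioc s 1) := by
    rw [← intervalIntegrable_iff_integrableOn_Ioc_of_le hs1]
    exact intervalIntegrable_inv_iff.2 (Or.inr h0)
  rw [← ofReal_integral_eq_lintegral_ofReal hInt, ← intervalIntegral.integral_of_le hs1,
    integral_inv h0, one_div, Real.log_inv]
  filter_upwards [ae_restrict_mem measurableSet_Ioc] with t ht
  exact inv_nonneg.2 (hs0.trans ht.1).le

/-! ### Values of the weight -/

lemma fwt_slantMap (h : ℝ → ℝ) (eps : ℕ → ℝ) (j : ℕ) {u : ℝ} (hu : u ∈ Set.Ioc (0 : ℝ) 1) :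
    fwt h eps (slantMap j u) = ENNReal.ofReal (min 1 (eps j * gfun h u)) := by
  have hfl : ⌊(10 * (j : ℝ) + u) / 10⌋ = (j : ℤ) := by
    rw [Int.floor_eq_iff]
    push_cast
    constructor <;> linarith [hu.1, hu.2]
  have h0 : u / 2 ≠ 0 := by linarith [hu.1]
  simp [fwt, slantMap, hfl, hu.1.ne']

lemma fwt_vertMap {h : ℝ → ℝ} (hh : gfun h 1 = 1) {eps : ℕ → ℝ} {j : ℕ} (hj : eps j ≤ 1)
    {y : ℝ} (hy : y ∈ Set.Icc (1 / 2 : ℝ) 1) :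
    fwt h eps (vertMap j y) = ENNReal.ofReal (eps j) := by
  have hfl : ⌊(10 * (j : ℝ) + 1) / 10⌋ = (j : ℤ) := by
    rw [Int.floor_eq_iff]
    push_cast
    constructor <;> linarith
  have h0 : y ≠ 0 := by linarith [hy.1]
  simp [fwt, vertMap, hfl, h0, hh, hj]

lemma fwt_of_snd_eq_zero (h : ℝ → ℝ) (eps : ℕ → ℝ) {w : ℝ × ℝ} (hw : w.2 = 0) :
    fwt h eps w = 1 := if_pos hw

lemma fwt_le_one {h : ℝ → ℝ} (hh : gfun h 1 = 1) {eps : ℕ → ℝ} (heps : ∀ j, eps j ≤ 1)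
    {w : ℝ × ℝ} (hw : w ∈ spaceX) : fwt h eps w ≤ 1 := by
  rcases mem_spaceX.1 hw with h0 | ⟨j, ⟨u, hu, rfl⟩ | ⟨y, hy, rfl⟩⟩
  · exact (fwt_of_snd_eq_zero h eps h0).le
  · rw [fwt_slantMap h eps j hu]
    exact ENNReal.ofReal_le_one.2 (min_le_left _ _)
  · rw [fwt_vertMap hh (heps j) hy]
    exact ENNReal.ofReal_le_one.2 (heps j)

/-! ### Elementary averages -/

lemma rpow_average_le {S : Set (ℝ × ℝ)} (hS : MeasurableSet S) {F : ℝ × ℝ → ℝ≥0∞} {c : ℝ≥0∞}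
    {p : ℝ} (hp : 0 < p) (hF : ∀ x ∈ S, F x ≤ c) :
    ((μH[1] S)⁻¹ * ∫⁻ x in S, F x ^ p ∂μH[1]) ^ (1 / p) ≤ c := by
  rw [one_div, ENNReal.rpow_inv_le_iff hp]
  calc (μH[1] S)⁻¹ * ∫⁻ x in S, F x ^ p ∂μH[1]
      ≤ (μH[1] S)⁻¹ * ∫⁻ _ in S, c ^ p ∂μH[1] := by
        gcongr 1
        exact setLIntegral_mono' hS fun x hx => ENNReal.rpow_le_rpow (hF x hx) hp.le
    _ = ((μH[1] S)⁻¹ * μH[1] S) * c ^ p := by rw [setLIntegral_const]; ring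
    _ ≤ 1 * c ^ p := by gcongr; exact ENNReal.inv_mul_le_one _
    _ = c ^ p := one_mul _

lemma le_average {S : Set (ℝ × ℝ)} (hS : MeasurableSet S) {F : ℝ × ℝ → ℝ≥0∞} {m : ℝ≥0∞}
    (h0 : μH[1] S ≠ 0) (ht : μH[1] S ≠ ⊤) (hF : ∀ x ∈ S, m ≤ F x) :
    m ≤ (μH[1] S)⁻¹ * ∫⁻ x in S, F x ∂μH[1] := by
  calc m = ((μH[1] S)⁻¹ * μH[1] S) * m := by rw [ENNReal.inv_mul_cancel h0 ht, one_mul]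
    _ = (μH[1] S)⁻¹ * ∫⁻ _ in S, m ∂μH[1] := by rw [setLIntegral_const]; ring
    _ ≤ _ := by
        gcongr 1
        exact setLIntegral_mono' hS hF

lemma reverseHolder_of_le_mul {S : Set (ℝ × ℝ)} (hS : MeasurableSet S) {F : ℝ × ℝ → ℝ≥0∞}
    {m K : ℝ≥0∞} {p : ℝ} (hp : 0 < p) (ht : μH[1] S ≠ ⊤) (hm : ∀ x ∈ S, m ≤ F x)
    (hK : ∀ x ∈ S, F x ≤ K * m) :
    ((μH[1] S)⁻¹ * ∫⁻ x in S, F x ^ p ∂μH[1]) ^ (1 / p)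
      ≤ K * ((μH[1] S)⁻¹ * ∫⁻ x in S, F x ∂μH[1]) := by
  rcases eq_or_ne (μH[1] S) 0 with h0 | h0
  · simp [Measure.restrict_eq_zero.2 h0, hp]
  · exact (rpow_average_le hS hp hK).trans (by gcongr; exact le_average hS h0 ht hm)

/-! ### The reverse Hölder inequality on each type of ball -/

section ReverseHolder

lemma reverseHolder_of_snd_lt {h : ℝ → ℝ} (hh : gfun h 1 = 1) {eps : ℕ → ℝ}
    (heps : ∀ j, eps j ≤ 1) {p : ℝ} (hp : 0 < p) {z : ℝ × ℝ} {r : ℝ} (hz : 0 ≤ z.2)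
    (hzr : z.2 < r) :
    ((μH[1] (ballX z r))⁻¹ * ∫⁻ x in ballX z r, fwt h eps x ^ p ∂μH[1]) ^ (1 / p)
      ≤ 5 * ((μH[1] (ballX z r))⁻¹ * ∫⁻ x in ballX z r, fwt h eps x ∂μH[1]) := by
  have hr : 0 < r := hz.trans_lt hzr
  refine (rpow_average_le (measurableSet_ballX z r) hp
    fun x hx => fwt_le_one hh heps hx.2).trans ?_
  have hsub : lineMap '' Set.Ioo (z.1 - r) (z.1 + r) ⊆ ballX z r := by
    rintro _ ⟨x, hx, rfl⟩
    refine ⟨mem_ball_iff.2 ⟨abs_lt.2 ⟨?_, ?_⟩, ?_⟩, mem_spaceX.2 (Or.inl rfl)⟩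
    · simp only [lineMap]; linarith [hx.1]
    · simp only [lineMap]; linarith [hx.2]
    · simpa [lineMap, abs_of_nonneg hz] using hzr
  have hInt : ENNReal.ofReal (2 * r) ≤ ∫⁻ x in ballX z r, fwt h eps x ∂μH[1] := by
    refine le_trans ?_ (lintegral_mono_set hsub)
    rw [lintegral_image_of_isometry isometry_lineMap]
    simp only [fwt_of_snd_eq_zero h eps (w := lineMap _) rfl]
    rw [setLIntegral_const, one_mul, Real.volume_Ioo]
    exact ENNReal.ofReal_le_ofReal (by linarith)
  have h10 : ENNReal.ofReal (10 * r) = 5 * ENNReal.ofReal (2 * r) := by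
    rw [← ENNReal.ofReal_ofNat 5, ← ENNReal.ofReal_mul (by norm_num)]
    congr 1; ring
  have hpos : ENNReal.ofReal (10 * r) ≠ 0 := by
    rw [Ne, ENNReal.ofReal_eq_zero]; linarith
  calc (1 : ℝ≥0∞) = (ENNReal.ofReal (10 * r))⁻¹ * ENNReal.ofReal (10 * r) :=
        (ENNReal.inv_mul_cancel hpos ENNReal.ofReal_ne_top).symm
    _ = 5 * ((ENNReal.ofReal (10 * r))⁻¹ * ENNReal.ofReal (2 * r)) := by
        nth_rw 2 [h10]; ring
    _ ≤ _ := by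
        gcongr
        exact hausdorffMeasure_ballX_le z hr

variable {α : ℝ} {eps : ℕ → ℝ}

lemma reverseHolder_of_dyadic (hα0 : 0 < α) (hα1 : α < 1) {j : ℕ} (hj : 0 < eps j) {p : ℝ}
    (hp : 0 < p) {S : Set (ℝ × ℝ)} (hS : MeasurableSet S) (ht : μH[1] S ≠ ⊤) {a : ℝ}
    (ha : a ∈ Set.Ioc (0 : ℝ) 1)
    (hw : ∀ w ∈ S, ∃ u ∈ Set.Ioc (0 : ℝ) 1, u ≤ 2 * a ∧ a ≤ 2 * u ∧
      fwt (h19 α) eps w = ENNReal.ofReal (min 1 (eps j * gfun (h19 α) u))) :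
    ((μH[1] S)⁻¹ * ∫⁻ x in S, fwt (h19 α) eps x ^ p ∂μH[1]) ^ (1 / p)
      ≤ 16 * ((μH[1] S)⁻¹ * ∫⁻ x in S, fwt (h19 α) eps x ∂μH[1]) := by
  have key : ∀ s t : ℝ, gfun (h19 α) s ≤ 4 * gfun (h19 α) t →
      min 1 (eps j * gfun (h19 α) s) ≤ 4 * min 1 (eps j * gfun (h19 α) t) := by
    intro s t hst
    have h1 : eps j * gfun (h19 α) s ≤ 4 * (eps j * gfun (h19 α) t) := by
      nlinarith
    rw [mul_min_of_nonneg _ _ (by norm_num : (0 : ℝ) ≤ 4)]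
    exact min_le_min (by norm_num) h1
  refine reverseHolder_of_le_mul hS
    (m := ENNReal.ofReal (min 1 (eps j * gfun (h19 α) a) / 4)) hp ht ?_ ?_
  · intro w hwS
    obtain ⟨u, hu, hua, hau, hf⟩ := hw w hwS
    rw [hf]
    refine ENNReal.ofReal_le_ofReal ?_
    linarith [key a u (gfun_h19_le_four_mul hα0 hα1 ha.1 ha.2 hu.1 hu.2 hua hau)]
  · intro w hwS
    obtain ⟨u, hu, hua, hau, hf⟩ := hw w hwS
    rw [hf, ← ENNReal.ofReal_ofNat 16, ← ENNReal.ofReal_mul (by norm_num)]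
    refine ENNReal.ofReal_le_ofReal ?_
    linarith [key u a (gfun_h19_le_four_mul hα0 hα1 hu.1 hu.2 ha.1 ha.2 hau hua)]

lemma reverseHolder_slantMap (hα0 : 0 < α) (hα1 : α < 1) (heps : ∀ j, 0 < eps j ∧ eps j ≤ 1)
    {p : ℝ} (hp : 0 < p) {j : ℕ} {a : ℝ} (ha : a ∈ Set.Ioc (0 : ℝ) 1) {r : ℝ} (hr : 0 < r)
    (hra : r ≤ a / 2) :
    ((μH[1] (ballX (slantMap j a) r))⁻¹ *
        ∫⁻ x in ballX (slantMap j a) r, fwt (h19 α) eps x ^ p ∂μH[1]) ^ (1 / p)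
      ≤ 16 * ((μH[1] (ballX (slantMap j a) r))⁻¹ *
        ∫⁻ x in ballX (slantMap j a) r, fwt (h19 α) eps x ∂μH[1]) := by
  refine reverseHolder_of_dyadic hα0 hα1 (heps j).1 hp (measurableSet_ballX _ _)
    (hausdorffMeasure_ballX_ne_top _ hr) ha fun w hw => ?_
  have h1 := abs_lt.1 (mem_ball_iff.1 hw.1).1
  rcases ballX_cases (by simp only [slantMap]; linarith [ha.1])
    (by simp only [slantMap]; linarith [ha.2]) (by simp only [slantMap]; linarith [ha.2])
    hra hw with ⟨u, hu, rfl⟩ | ⟨y, hy, rfl⟩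
  · simp only [slantMap] at h1
    exact ⟨u, hu, by linarith, by linarith, fwt_slantMap _ _ _ hu⟩
  · simp only [slantMap, vertMap] at h1
    refine ⟨1, ⟨one_pos, le_rfl⟩, by linarith, by linarith [ha.2], ?_⟩
    rw [fwt_vertMap (gfun_h19_one α) (heps j).2 hy, gfun_h19_one, mul_one,
      min_eq_right (heps j).2]

lemma reverseHolder_vertMap_of_lt (hα0 : 0 < α) (hα1 : α < 1)
    (heps : ∀ j, 0 < eps j ∧ eps j ≤ 1)
    {p : ℝ} (hp : 0 < p) {j : ℕ} {b : ℝ} (hb : b ∈ Set.Icc (1 / 2 : ℝ) 1) {r : ℝ} (hr : 0 < r)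
    (hr2 : r < 1 / 2) :
    ((μH[1] (ballX (vertMap j b) r))⁻¹ *
        ∫⁻ x in ballX (vertMap j b) r, fwt (h19 α) eps x ^ p ∂μH[1]) ^ (1 / p)
      ≤ 16 * ((μH[1] (ballX (vertMap j b) r))⁻¹ *
        ∫⁻ x in ballX (vertMap j b) r, fwt (h19 α) eps x ∂μH[1]) := by
  refine reverseHolder_of_dyadic hα0 hα1 (heps j).1 hp (measurableSet_ballX _ _)
    (hausdorffMeasure_ballX_ne_top _ hr) (a := 1) ⟨one_pos, le_rfl⟩ fun w hw => ?_
  have h1 := abs_lt.1 (mem_ball_iff.1 hw.1).1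
  rcases ballX_cases (by simp only [vertMap]; linarith)
    (by simp only [vertMap]; linarith) (by simp only [vertMap]; linarith [hb.2])
    (by simp only [vertMap]; linarith [hb.1]) hw with ⟨u, hu, rfl⟩ | ⟨y, hy, rfl⟩
  · simp only [slantMap, vertMap] at h1
    exact ⟨u, hu, by linarith [hu.2], by linarith, fwt_slantMap _ _ _ hu⟩
  · refine ⟨1, ⟨one_pos, le_rfl⟩, by norm_num, by norm_num, ?_⟩
    rw [fwt_vertMap (gfun_h19_one α) (heps j).2 hy, gfun_h19_one, mul_one,
      min_eq_right (heps j).2]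

lemma ballX_vertMap_subset (j : ℕ) {b r : ℝ} (hb : b ∈ Set.Icc (1 / 2 : ℝ) 1) (hrb : r ≤ b) :
    ballX (vertMap j b) r ⊆ segWj j := by
  intro w hw
  rw [segWj_eq]
  rcases ballX_cases (by simp only [vertMap]; linarith)
    (by simp only [vertMap]; linarith) (by simp only [vertMap]; linarith [hb.2])
    hrb hw with ⟨u, hu, rfl⟩ | ⟨y, hy, rfl⟩
  · exact Or.inl ⟨u, hu, rfl⟩
  · exact Or.inr ⟨y, hy, rfl⟩

lemma half_le_hausdorffMeasure_ballX_vertMap (j : ℕ) {b r : ℝ}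
    (hb : b ∈ Set.Icc (1 / 2 : ℝ) 1) (hr : 1 / 2 ≤ r) :
    2⁻¹ ≤ μH[1] (ballX (vertMap j b) r) := by
  have hsub : vertMap j '' Set.Ioo (1 / 2) 1 ⊆ ballX (vertMap j b) r := by
    rintro _ ⟨y, hy, rfl⟩
    have h1 := hy.1
    have h2 := hy.2
    refine ⟨mem_ball_iff.2 ⟨?_, abs_lt.2 ⟨?_, ?_⟩⟩,
      mem_spaceX.2 (Or.inr ⟨j, Or.inr ⟨y, ⟨h1.le, h2.le⟩, rfl⟩⟩)⟩
    · simp only [vertMap, sub_self, abs_zero]; linarith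
    · simp only [vertMap]; linarith [hb.2]
    · simp only [vertMap]; linarith [hb.1]
  refine le_trans (le_of_eq ?_) (measure_mono hsub)
  rw [hausdorffMeasure_image_of_isometry (isometry_vertMap j), Real.volume_Ioo,
    show (1 : ℝ) - 1 / 2 = 2⁻¹ by norm_num, ENNReal.ofReal_inv_of_pos two_pos,
    ENNReal.ofReal_ofNat]

lemma lintegral_fwt_rpow_le (heps : ∀ j, 0 < eps j ∧ eps j ≤ 1) {p : ℝ} (hp : 0 < p)
    (hpα : p ≤ 1 / α) {j : ℕ} {S : Set (ℝ × ℝ)} (hS : S ⊆ segWj j) :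
    ∫⁻ x in S, fwt (h19 α) eps x ^ p ∂μH[1] ≤ ENNReal.ofReal (eps j) ^ p *
      ((∫⁻ t in Set.Ioc (0 : ℝ) 1, ENNReal.ofReal (gfun (h19 α) t) ^ (1 / α)) + 2⁻¹) := by
  rw [segWj_eq] at hS
  refine (lintegral_mono_set hS).trans ((lintegral_union_le _ _ _).trans ?_)
  rw [lintegral_image_of_isometry (isometry_slantMap j),
    lintegral_image_of_isometry (isometry_vertMap j), mul_add,
    ← lintegral_const_mul' _ _ (ENNReal.rpow_ne_top_of_nonneg hp.le ENNReal.ofReal_ne_top)]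
  refine add_le_add (setLIntegral_mono' measurableSet_Ioc fun u hu => ?_) ?_
  · rw [fwt_slantMap _ _ _ hu]
    calc ENNReal.ofReal (min 1 (eps j * gfun (h19 α) u)) ^ p
        ≤ ENNReal.ofReal (eps j * gfun (h19 α) u) ^ p := by
          gcongr; exact min_le_right _ _
      _ = ENNReal.ofReal (eps j) ^ p * ENNReal.ofReal (gfun (h19 α) u) ^ p := by
          rw [ENNReal.ofReal_mul (heps j).1.le, ENNReal.mul_rpow_of_nonneg _ _ hp.le]
      _ ≤ _ := by
          gcongr 1
          exact ENNReal.rpow_le_rpow_of_exponent_le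
            (ENNReal.one_le_ofReal.2 (one_le_gfun _ _)) hpα
  · calc ∫⁻ y in Set.Icc (1 / 2 : ℝ) 1, fwt (h19 α) eps (vertMap j y) ^ p
        = ∫⁻ _ in Set.Icc (1 / 2 : ℝ) 1, ENNReal.ofReal (eps j) ^ p :=
          setLIntegral_congr_fun measurableSet_Icc fun y hy => by
            rw [fwt_vertMap (gfun_h19_one α) (heps j).2 hy]
      _ ≤ _ := by
          rw [setLIntegral_const, Real.volume_Icc, show (1 : ℝ) - 1 / 2 = 2⁻¹ by norm_num,
            ENNReal.ofReal_inv_of_pos two_pos, ENNReal.ofReal_ofNat]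

lemma reverseHolder_vertMap_of_le (heps : ∀ j, 0 < eps j ∧ eps j ≤ 1)
    {p : ℝ} (hp : 0 < p) (hpα : p ≤ 1 / α) {j : ℕ} {b : ℝ} (hb : b ∈ Set.Icc (1 / 2 : ℝ) 1)
    {r : ℝ} (hr2 : 1 / 2 ≤ r) (hrb : r ≤ b) :
    ((μH[1] (ballX (vertMap j b) r))⁻¹ *
        ∫⁻ x in ballX (vertMap j b) r, fwt (h19 α) eps x ^ p ∂μH[1]) ^ (1 / p)
      ≤ (2 * ((∫⁻ t in Set.Ioc (0 : ℝ) 1, ENNReal.ofReal (gfun (h19 α) t) ^ (1 / α)) + 2⁻¹)) ^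
          (1 / p) * ((μH[1] (ballX (vertMap j b) r))⁻¹ *
        ∫⁻ x in ballX (vertMap j b) r, fwt (h19 α) eps x ∂μH[1]) := by
  set I := (∫⁻ t in Set.Ioc (0 : ℝ) 1, ENNReal.ofReal (gfun (h19 α) t) ^ (1 / α)) + 2⁻¹
  have hhalf := half_le_hausdorffMeasure_ballX_vertMap j hb hr2
  have hsub := ballX_vertMap_subset j hb hrb
  have hinv : (μH[1] (ballX (vertMap j b) r))⁻¹ ≤ 2 := ENNReal.inv_le_iff_inv_le.1 hhalf
  calc _ ≤ (2 * (ENNReal.ofReal (eps j) ^ p * I)) ^ (1 / p) := by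
        gcongr
        exact lintegral_fwt_rpow_le heps hp hpα hsub
    _ = (2 * I) ^ (1 / p) * ENNReal.ofReal (eps j) := by
        rw [mul_left_comm, mul_comm, ENNReal.mul_rpow_of_nonneg _ _ (by positivity),
          ← ENNReal.rpow_mul, mul_one_div_cancel hp.ne', ENNReal.rpow_one]
    _ ≤ _ := by
        gcongr 1
        refine le_average (measurableSet_ballX _ _) ?_
          (hausdorffMeasure_ballX_ne_top _ (by linarith)) fun w hw => ?_
        · exact (lt_of_lt_of_le (by simp) hhalf).ne'
        · have hw' := hsub hw
          rw [segWj_eq] at hw'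
          rcases hw' with ⟨u, hu, rfl⟩ | ⟨y, hy, rfl⟩
          · rw [fwt_slantMap _ _ _ hu]
            refine ENNReal.ofReal_le_ofReal (le_min (heps j).2 ?_)
            exact le_mul_of_one_le_right (heps j).1.le (one_le_gfun _ _)
          · rw [fwt_vertMap (gfun_h19_one α) (heps j).2 hy]

/-- On a ball containing `W_j`, the reverse Hölder inequality bounds a truncated integral
of `t⁻¹`. -/
lemma neg_log_le_of_reverseHolder (hα0 : 0 < α) (hα1 : α < 1)
    (heps : ∀ j, 0 < eps j ∧ eps j ≤ 1) {p : ℝ} (hp : 0 < p) {c : ℝ}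
    (hc : ∀ t ∈ Set.Ioc (0 : ℝ) 1, c * t⁻¹ ≤ gfun (h19 α) t ^ p) (hc0 : 0 < c) {C : ℝ≥0∞} {j : ℕ}
    (hRH : ((μH[1] (ballX (vertMap j 1) 1))⁻¹ *
        ∫⁻ x in ballX (vertMap j 1) 1, fwt (h19 α) eps x ^ p ∂μH[1]) ^ (1 / p)
      ≤ C * ((μH[1] (ballX (vertMap j 1) 1))⁻¹ *
        ∫⁻ x in ballX (vertMap j 1) 1, fwt (h19 α) eps x ∂μH[1]))
    {s : ℝ} (hs0 : 0 < s) (hs1 : s ≤ 1) (hsj : eps j ≤ s ^ α) :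
    ENNReal.ofReal (c * -Real.log s) ≤ 10 * (C * (2 *
      ((∫⁻ t in Set.Ioc (0 : ℝ) 1, ENNReal.ofReal (gfun (h19 α) t) ^ (1 / α)) + 2⁻¹))) ^ p := by
  set I := (∫⁻ t in Set.Ioc (0 : ℝ) 1, ENNReal.ofReal (gfun (h19 α) t) ^ (1 / α)) + 2⁻¹
  set S := ballX (vertMap j 1) 1
  set E := ENNReal.ofReal (eps j)
  have hb : (1 : ℝ) ∈ Set.Icc (1 / 2 : ℝ) 1 := ⟨by norm_num, le_rfl⟩
  have hhalf : 2⁻¹ ≤ μH[1] S := half_le_hausdorffMeasure_ballX_vertMap j hb (by norm_num)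
  have hsub : S ⊆ segWj j := ballX_vertMap_subset j hb le_rfl
  have hinv : (μH[1] S)⁻¹ ≤ 2 := ENNReal.inv_le_iff_inv_le.1 hhalf
  have h10 : μH[1] S ≤ 10 := by
    simpa using hausdorffMeasure_ballX_le (vertMap j 1) one_pos
  have hS0 : μH[1] S ≠ 0 := (lt_of_lt_of_le (by simp) hhalf).ne'
  have hSt : μH[1] S ≠ ⊤ := (h10.trans_lt (by simp)).ne
  have hupper : ∫⁻ x in S, fwt (h19 α) eps x ^ p ∂μH[1] ≤
      E ^ p * (10 * (C * (2 * I)) ^ p) := by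
    have h1 : ∫⁻ x in S, fwt (h19 α) eps x ∂μH[1] ≤ E * I := by
      simpa only [ENNReal.rpow_one] using
        lintegral_fwt_rpow_le heps one_pos ((one_lt_div hα0).2 hα1).le hsub
    have h2 : (μH[1] S)⁻¹ * ∫⁻ x in S, fwt (h19 α) eps x ^ p ∂μH[1]
        ≤ (C * (2 * (E * I))) ^ p := by
      rw [← ENNReal.rpow_inv_le_iff hp, ← one_div p]
      exact hRH.trans (by gcongr)
    calc ∫⁻ x in S, fwt (h19 α) eps x ^ p ∂μH[1]
        = μH[1] S * ((μH[1] S)⁻¹ * ∫⁻ x in S, fwt (h19 α) eps x ^ p ∂μH[1]) := by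
          rw [← mul_assoc, ENNReal.mul_inv_cancel hS0 hSt, one_mul]
      _ ≤ 10 * (C * (2 * (E * I))) ^ p := by gcongr
      _ = E ^ p * (10 * (C * (2 * I)) ^ p) := by
          rw [show C * (2 * (E * I)) = E * (C * (2 * I)) by ring,
            ENNReal.mul_rpow_of_nonneg _ _ hp.le]
          ring
  have hlower : E ^ p * ENNReal.ofReal (c * -Real.log s) ≤
      ∫⁻ x in S, fwt (h19 α) eps x ^ p ∂μH[1] := by
    have hsubU : slantMap j '' Set.Ioc s 1 ⊆ S := by
      rintro _ ⟨u, hu, rfl⟩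
      have h1 := hs0.trans hu.1
      have h2 := hu.2
      refine ⟨mem_ball_iff.2 ⟨abs_lt.2 ⟨?_, ?_⟩, abs_lt.2 ⟨?_, ?_⟩⟩,
        mem_spaceX.2 (Or.inr ⟨j, Or.inl ⟨u, ⟨h1, h2⟩, rfl⟩⟩)⟩ <;>
      · simp only [slantMap, vertMap]; linarith
    refine le_trans ?_ (lintegral_mono_set hsubU)
    rw [lintegral_image_of_isometry (isometry_slantMap j), ENNReal.ofReal_mul hc0.le,
      ← setLIntegral_inv_Ioc hs0 hs1, ← lintegral_const_mul' _ _ ENNReal.ofReal_ne_top,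
      ← lintegral_const_mul' _ _ (ENNReal.rpow_ne_top_of_nonneg hp.le ENNReal.ofReal_ne_top)]
    refine setLIntegral_mono' measurableSet_Ioc fun u hu => ?_
    have hu' : u ∈ Set.Ioc (0 : ℝ) 1 := ⟨hs0.trans hu.1, hu.2⟩
    have hle : eps j * gfun (h19 α) u ≤ 1 := by
      calc eps j * gfun (h19 α) u ≤ s ^ α * u ^ (-α) :=
            mul_le_mul hsj (gfun_h19_le_rpow hα0 hu'.1 hu'.2)
              (zero_le_one.trans (one_le_gfun _ _)) (by positivity)
        _ ≤ s ^ α * s ^ (-α) := by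
            gcongr ?_ * ?_
            exact Real.rpow_le_rpow_of_nonpos hs0 hu.1.le (by linarith)
        _ = 1 := by rw [← Real.rpow_add hs0, add_neg_cancel, Real.rpow_zero]
    rw [fwt_slantMap _ _ _ hu', min_eq_right hle, ENNReal.ofReal_mul (heps j).1.le,
      ENNReal.mul_rpow_of_nonneg _ _ hp.le, ← ENNReal.ofReal_mul hc0.le,
      ENNReal.ofReal_rpow_of_nonneg (zero_le_one.trans (one_le_gfun _ _)) hp.le]
    gcongr
    exact hc u hu'
  have hE0 : E ^ p ≠ 0 := by
    rw [Ne, ENNReal.rpow_eq_zero_iff_of_pos hp, ENNReal.ofReal_eq_zero, not_le]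
    exact (heps j).1
  have hEt : E ^ p ≠ ⊤ := ENNReal.rpow_ne_top_of_nonneg hp.le ENNReal.ofReal_ne_top
  exact (ENNReal.mul_le_mul_iff_right hE0 hEt).1 (hlower.trans hupper)

end ReverseHolder

/-- Failure of the strong Gehring lemma:  with `h(t) = t^{-α} (log(e/t))⁻¹`, `0 < α < 1`,
the weight `f = f_h` belongs to the strong class `RH_p` exactly for `1 < p ≤ 1/α`; in
particular `f ∈ RH_{1/α}` but `f ∉ RH_{1/α + ε}` for every `ε > 0`, so the strong
self-improvement `RH_q ⇒ RH_{q+ε}` fails in `X`. -/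
theorem fwt_strong_gehring_fails (α : ℝ) (hα0 : 0 < α) (hα1 : α < 1)
    (eps : ℕ → ℝ) (heps : ∀ j, 0 < eps j ∧ eps j ≤ 1)
    (hlim : Filter.Tendsto eps Filter.atTop (nhds 0)) :
    (∀ p : ℝ, 1 < p → p ≤ 1 / α →
      ∃ C : ℝ≥0∞, C ≠ ⊤ ∧ ∀ z ∈ spaceX, ∀ r : ℝ, 0 < r →
        ((muX (Metric.ball z r))⁻¹
            * ∫⁻ x in Metric.ball z r, fwt (h19 α) eps x ^ p ∂muX) ^ (1 / p)
          ≤ C * ((muX (Metric.ball z r))⁻¹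
              * ∫⁻ x in Metric.ball z r, fwt (h19 α) eps x ∂muX)) ∧
    (∀ p : ℝ, 1 / α < p →
      ¬ ∃ C : ℝ≥0∞, C ≠ ⊤ ∧ ∀ z ∈ spaceX, ∀ r : ℝ, 0 < r →
        ((muX (Metric.ball z r))⁻¹
            * ∫⁻ x in Metric.ball z r, fwt (h19 α) eps x ^ p ∂muX) ^ (1 / p)
          ≤ C * ((muX (Metric.ball z r))⁻¹
              * ∫⁻ x in Metric.ball z r, fwt (h19 α) eps x ∂muX)) := by
  simp only [muX_ball, lintegral_ball_muX]
  have hIfin : (∫⁻ t in Set.Ioc (0 : ℝ) 1, ENNReal.ofReal (gfun (h19 α) t) ^ (1 / α)) + 2⁻¹ ≠ ⊤ :=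
    ENNReal.add_ne_top.2 ⟨(lintegral_gfun_h19_rpow_lt_top hα0 hα1).ne, by simp⟩
  constructor
  · intro p hp1 hpα
    have hp : 0 < p := one_pos.trans hp1
    refine ⟨16 + (2 * ((∫⁻ t in Set.Ioc (0 : ℝ) 1,
      ENNReal.ofReal (gfun (h19 α) t) ^ (1 / α)) + 2⁻¹)) ^ (1 / p), ?_, ?_⟩
    · exact ENNReal.add_ne_top.2 ⟨by simp, ENNReal.rpow_ne_top_of_nonneg (by positivity)
        (ENNReal.mul_ne_top (by simp) hIfin)⟩
    intro z hz r hr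
    have hz2 : 0 ≤ z.2 := by
      rcases mem_spaceX.1 hz with h | ⟨j, ⟨u, hu, rfl⟩ | ⟨y, hy, rfl⟩⟩
      · exact h.ge
      · simp only [slantMap]; linarith [hu.1]
      · simp only [vertMap]; linarith [hy.1]
    rcases lt_or_ge z.2 r with hzr | hzr
    · refine (reverseHolder_of_snd_lt (gfun_h19_one α) (fun j => (heps j).2) hp hz2 hzr).trans ?_
      gcongr
      exact le_add_right (by norm_num)
    rcases mem_spaceX.1 hz with h | ⟨j, ⟨u, hu, rfl⟩ | ⟨y, hy, rfl⟩⟩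
    · linarith
    · refine (reverseHolder_slantMap hα0 hα1 heps hp hu hr hzr).trans ?_
      gcongr
      exact le_self_add
    · rcases lt_or_ge r (1 / 2) with hr2 | hr2
      · refine (reverseHolder_vertMap_of_lt hα0 hα1 heps hp hy hr hr2).trans ?_
        gcongr
        exact le_self_add
      · refine (reverseHolder_vertMap_of_le heps hp hpα hy hr2 hzr).trans ?_
        gcongr
        exact le_add_self
  · rintro p hp ⟨C, hC, hRH⟩
    have hp0 : 0 < p := (by positivity : (0 : ℝ) < 1 / α).trans hp
    obtain ⟨c, hc0, hc⟩ := exists_div_le_gfun_h19_rpow hα0 hp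
    set M := 10 * (C * (2 * ((∫⁻ t in Set.Ioc (0 : ℝ) 1,
      ENNReal.ofReal (gfun (h19 α) t) ^ (1 / α)) + 2⁻¹))) ^ p with hM
    have hMt : M ≠ ⊤ := ENNReal.mul_ne_top (by simp) (ENNReal.rpow_ne_top_of_nonneg hp0.le
      (ENNReal.mul_ne_top hC (ENNReal.mul_ne_top (by simp) hIfin)))
    set L := M.toReal / c + 1
    have hL : 0 < L := by positivity
    obtain ⟨j, hj⟩ := (hlim.eventually_lt_const
      (Real.rpow_pos_of_pos (Real.exp_pos (-L)) α)).exists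
    have hlog := neg_log_le_of_reverseHolder hα0 hα1 heps hp0 hc hc0
      (hRH (vertMap j 1) (mem_spaceX.2 (Or.inr ⟨j, Or.inr ⟨1, ⟨by norm_num, le_rfl⟩, rfl⟩⟩))
        1 one_pos) (Real.exp_pos (-L)) (Real.exp_le_one_iff.2 (by linarith)) hj.le
    rw [← hM, Real.log_exp, neg_neg, ENNReal.ofReal_le_iff_le_toReal hMt, mul_add, mul_one,
      mul_div_cancel₀ _ hc0.ne'] at hlog
    linarith

end Counterexample
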